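/- arXiv:1405.7260 — 2 statements merged into one kernel-verified Lean document; each statement's English description precedes it below -/
import Mathlib

section
/- Let A be a set with exactly 4 elements, i : A → A an involution without fixed points, and q a symmetric ternary operation on A satisfying q(x,y,i(x)) = y and q(x,y,x) = x for all x, y ∈ A. Then i preserves q, that is, i(q(x,y,z)) = q(i(x),i(y),i(z)) for all x, y, z ∈ A; in particular i is an endomorphism of the algebra (A; i, q). -/
/-- A ternary operation is symmetric if it is invariant under all permutations of its
three arguments. -/
def IsSymm3 {A : Type*} (q : A → A → A → A) : Prop :=
  ∀ x y z : A, q x y z = q x z y ∧ q x y z = q y x z ∧ q x y z = q y z x ∧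
    q x y z = q z x y ∧ q x y z = q z y x

/-- If `i` is a fixed-point-free involution on a set with four elements, then among any three
elements two are equal or swapped by `i`. -/
theorem eq_or_eq_involution_of_card_eq_four {A : Type*} [Fintype A] (hA : Fintype.card A = 4)
    {i : A → A} (hii : ∀ x, i (i x) = x) (hif : ∀ x, i x ≠ x) (x y z : A) :
    y = x ∨ y = i x ∨ z = x ∨ z = i x ∨ z = y ∨ z = i y := by
  classical
  by_cases hyx : y = x
  · exact Or.inl hyx
  by_cases hyi : y = i x
  · exact Or.inr (Or.inl hyi)
  have hinj : Function.Injective i := Function.LeftInverse.injective hii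
  have hcard : ({x, i x, y, i y} : Finset A).card = 4 := by
    have h1 : x ≠ i y := fun h => hyi (by rw [h, hii])
    have h2 : i x ≠ i y := fun h => hyx (hinj h).symm
    simp [Ne.symm (hif x), Ne.symm (hif y), Ne.symm hyx, Ne.symm hyi, h1, h2]
  have huniv : ({x, i x, y, i y} : Finset A) = Finset.univ :=
    Finset.eq_univ_of_card _ (hcard.trans hA.symm)
  have hz : z ∈ ({x, i x, y, i y} : Finset A) := huniv ▸ Finset.mem_univ z
  simp only [Finset.mem_insert, Finset.mem_singleton] at hz
  tauto

/-- Let A be a set with exactly 4 elements, i an involution without fixed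
points, and q a symmetric ternary operation satisfying q(x,y,i(x)) = y and q(x,y,x) = x.
Then i preserves q: i(q(x,y,z)) = q(i(x),i(y),i(z)) for all x, y, z; in particular i is
an endomorphism of the algebra (A; i, q). -/
theorem stmt_9 (A : Type*) [Fintype A] (hA : Fintype.card A = 4)
    (i : A → A) (hii : ∀ x, i (i x) = x) (hif : ∀ x, i x ≠ x)
    (q : A → A → A → A) (hsymm : IsSymm3 q)
    (hq1 : ∀ x y, q x y (i x) = y) (hq2 : ∀ x y, q x y x = x) :
    ∀ x y z : A, i (q x y z) = q (i x) (i y) (i z) := by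
  have hmaj (x y : A) : q x x y = x := by rw [(hsymm x x y).1, hq2]
  have hmaj' (x y : A) : q y x x = x := by rw [(hsymm y x x).2.1, hq2]
  have hopp (x y : A) : q x (i x) y = y := by rw [(hsymm x (i x) y).1, hq1]
  have hopp' (x y : A) : q y x (i x) = y := by rw [(hsymm y x (i x)).2.1, hq1]
  intro x y z
  rcases eq_or_eq_involution_of_card_eq_four hA hii hif x y z with
    rfl | rfl | rfl | rfl | rfl | rfl
  · rw [hmaj, hmaj]
  · rw [hopp, hopp]
  · rw [hq2, hq2]
  · rw [hq1, hq1]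
  · rw [hmaj', hmaj']
  · rw [hopp', hopp']
end

section
/- Let K be a division ring, V a K-vector space, and A₀ a linear subspace of V such that the quotient space V/A₀ has finite dimension n. Consider the monoid, under composition, of all K-linear endomorphisms of V that fix A₀ pointwise. Then every subsemilattice of this monoid has at most 2^n elements, and there exists a subsemilattice with exactly 2^n elements. -/
/-- A set of pairwise commuting idempotent endomorphisms of a finite-dimensional space `W` is
finite, with at most `2 ^ dim W` elements. -/
theorem Module.End.finite_and_ncard_le_of_commute_of_isIdempotentElem {K : Type*} [DivisionRing K]
    {W : Type*} [AddCommGroup W] [Module K W] [FiniteDimensional K W] (E : Set (Module.End K W))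
    (hidem : ∀ f ∈ E, f * f = f) (hcomm : ∀ f ∈ E, ∀ g ∈ E, f * g = g * f) :
    E.Finite ∧ E.ncard ≤ 2 ^ Module.finrank K W := by
  induction hd : Module.finrank K W using Nat.strong_induction_on generalizing W with
  | _ d ih =>
  have hidem' : ∀ f ∈ E, ∀ x, f (f x) = f x := fun f hf x => LinearMap.congr_fun (hidem f hf) x
  have hcomm' : ∀ f ∈ E, ∀ g ∈ E, ∀ x, f (g x) = g (f x) :=
    fun f hf g hg x => LinearMap.congr_fun (hcomm f hf g hg) x
  by_cases htriv : E ⊆ {0, 1}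
  · refine ⟨(Set.toFinite {0, 1}).subset htriv, ?_⟩
    rcases Nat.eq_zero_or_pos d with h0 | hpos
    · have : Subsingleton W := Module.finrank_zero_iff.mp (hd.trans h0)
      have hE : E.Subsingleton := fun f _ g _ => LinearMap.ext fun x => Subsingleton.elim _ _
      simpa [h0] using Set.ncard_le_one_iff_subsingleton.mpr hE
    · calc E.ncard ≤ ({0, 1} : Set (Module.End K W)).ncard :=
            Set.ncard_le_ncard htriv (Set.toFinite _)
        _ ≤ 2 := (Set.ncard_insert_le _ _).trans (by rw [Set.ncard_singleton])
        _ ≤ 2 ^ d := Nat.le_self_pow hpos.ne' 2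
  · obtain ⟨ε, hε, hne⟩ := Set.not_subset.mp htriv
    simp only [Set.mem_insert_iff, Set.mem_singleton_iff, not_or] at hne
    have hsum := LinearMap.finrank_range_add_finrank_ker ε
    have hker : 0 < Module.finrank K (LinearMap.ker ε) := by
      rw [Nat.pos_iff_ne_zero]
      intro h
      have hinj : Function.Injective ε := LinearMap.ker_eq_bot.mp (Submodule.finrank_eq_zero.mp h)
      exact hne.2 (LinearMap.ext fun x => hinj (hidem' ε hε x))
    have hrange : 0 < Module.finrank K (LinearMap.range ε) := by
      rw [Nat.pos_iff_ne_zero]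
      intro h
      exact hne.1 (LinearMap.range_eq_bot.mp (Submodule.finrank_eq_zero.mp h))
    let restr (U : Submodule K W) : Set (Module.End K U) :=
      {g | ∃ f ∈ E, ∀ x, (g x : W) = f x}
    have hrestr (U : Submodule K W) (hU : Module.finrank K U < d) :
        (restr U).Finite ∧ (restr U).ncard ≤ 2 ^ Module.finrank K U := by
      refine ih _ hU (restr U) ?_ ?_ rfl
      · rintro g ⟨f, hf, hgf⟩
        ext x
        simp [hgf, hidem' f hf]
      · rintro g ⟨f, hf, hgf⟩ g' ⟨f', hf', hgf'⟩
        ext x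
        simp [hgf, hgf', hcomm' f hf f' hf']
    obtain ⟨hRfin, hRcard⟩ := hrestr (LinearMap.range ε) (by omega)
    obtain ⟨hNfin, hNcard⟩ := hrestr (LinearMap.ker ε) (by omega)
    have hmapR : ∀ f ∈ E, ∀ x ∈ LinearMap.range ε, f x ∈ LinearMap.range ε := by
      rintro f hf _ ⟨y, rfl⟩
      exact ⟨f y, hcomm' ε hε f hf y⟩
    have hmapN : ∀ f ∈ E, ∀ x ∈ LinearMap.ker ε, f x ∈ LinearMap.ker ε := by
      intro f hf x hx
      rw [LinearMap.mem_ker] at hx ⊢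
      rw [hcomm' ε hε f hf, hx, map_zero]
    let φ : E → ↥(restr (LinearMap.range ε) ×ˢ restr (LinearMap.ker ε)) := fun f =>
      ⟨(f.1.restrict (hmapR f f.2), f.1.restrict (hmapN f f.2)),
        ⟨f, f.2, fun _ => rfl⟩, ⟨f, f.2, fun _ => rfl⟩⟩
    have hφ : Function.Injective φ := by
      intro f g h
      have h' := congrArg Subtype.val h
      refine Subtype.ext (LinearMap.ext fun x => ?_)
      have h1 : f.1 (ε x) = g.1 (ε x) := congrArg Subtype.val
        (LinearMap.congr_fun (congrArg Prod.fst h') ⟨ε x, x, rfl⟩)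
      have h2 : f.1 (x - ε x) = g.1 (x - ε x) := congrArg Subtype.val
        (LinearMap.congr_fun (congrArg Prod.snd h') ⟨x - ε x, by simp [hidem' ε hε]⟩)
      rw [← sub_add_cancel x (ε x), map_add, map_add, h1, h2]
    have := (hRfin.prod hNfin).to_subtype
    refine ⟨Set.finite_coe_iff.mp (_root_.Finite.of_injective φ hφ), ?_⟩
    calc E.ncard ≤ (restr (LinearMap.range ε) ×ˢ restr (LinearMap.ker ε)).ncard :=
            Nat.card_le_card_of_injective φ hφ
        _ = (restr (LinearMap.range ε)).ncard * (restr (LinearMap.ker ε)).ncard := Set.ncard_prod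
        _ ≤ 2 ^ Module.finrank K (LinearMap.range ε) * 2 ^ Module.finrank K (LinearMap.ker ε) :=
            Nat.mul_le_mul hRcard hNcard
        _ = 2 ^ d := by rw [← pow_add, hsum, hd]

/-- Commuting idempotent endomorphisms that fix `A₀` pointwise are equal as soon as they agree
modulo `A₀`. -/
theorem Module.End.eq_of_commute_of_forall_sub_mem {K V : Type*} [Ring K] [AddCommGroup V]
    [Module K V] {A₀ : Submodule K V} {f g : Module.End K V} (hf : ∀ a ∈ A₀, f a = a)
    (hg : ∀ a ∈ A₀, g a = a) (hff : f * f = f) (hgg : g * g = g) (hfg : f * g = g * f)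
    (h : ∀ x, f x - g x ∈ A₀) : f = g := by
  ext x
  have hff' : f (f x) = f x := LinearMap.congr_fun hff x
  have hgg' : g (g x) = g x := LinearMap.congr_fun hgg x
  have hfg' : f (g x) = g (f x) := LinearMap.congr_fun hfg x
  have h1 : f (g x) = g x := by simpa [hff'] using hf _ (h x)
  have h2 : g (f x) = f x := by simpa [hgg'] using hg _ (h x)
  rw [← h1, hfg', h2]

/-- The endomorphism of `M × (ι → K)` that is the identity on `M` and on the coordinates in `s`,
and kills the other coordinates. -/
noncomputable def Module.End.coordProj (K M : Type*) [Semiring K] [AddCommMonoid M] [Module K M]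
    {ι : Type*} [DecidableEq ι] (s : Finset ι) : Module.End K (M × (ι → K)) :=
  LinearMap.prodMap LinearMap.id
    (LinearMap.pi fun i => if i ∈ s then LinearMap.proj i else 0)

theorem Module.End.coordProj_mul (K M : Type*) [Semiring K] [AddCommMonoid M] [Module K M]
    {ι : Type*} [DecidableEq ι] (s t : Finset ι) :
    coordProj K M s * coordProj K M t = coordProj K M (s ∩ t) := by
  refine LinearMap.ext fun ⟨m, c⟩ => Prod.ext rfl (funext fun i => ?_)
  by_cases hs : i ∈ s <;> by_cases ht : i ∈ t <;> simp [coordProj, hs, ht]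

theorem Module.End.coordProj_injective (K M : Type*) [Semiring K] [Nontrivial K] [AddCommMonoid M]
    [Module K M] {ι : Type*} [DecidableEq ι] :
    Function.Injective (coordProj K M : Finset ι → Module.End K (M × (ι → K))) := by
  intro s t h
  ext i
  have hi := congrArg (fun f : Module.End K (M × (ι → K)) => (f (0, fun _ => 1)).2 i) h
  by_cases hs : i ∈ s <;> by_cases ht : i ∈ t <;> simp [coordProj, hs, ht] at hi ⊢


/-- Let K be a division ring, V a K-vector space, and A₀ a linear subspace
of V such that V/A₀ has finite dimension n. Consider the monoid, under composition, of all
K-linear endomorphisms of V that fix A₀ pointwise. Then every subsemilattice of this monoid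
has at most 2^n elements, and there exists a subsemilattice with exactly 2^n elements. -/
theorem stmt_16 (K : Type*) [DivisionRing K] (V : Type*) [AddCommGroup V] [Module K V]
    (A₀ : Submodule K V) [FiniteDimensional K (V ⧸ A₀)]
    (n : ℕ) (hn : Module.finrank K (V ⧸ A₀) = n) :
    (∀ E : Set (Module.End K V),
        (∀ ε ∈ E, ∀ a ∈ A₀, ε a = a) →
        (∀ ε₁ ∈ E, ∀ ε₂ ∈ E, ε₁ * ε₂ ∈ E) →
        (∀ ε ∈ E, ε * ε = ε) →
        (∀ ε₁ ∈ E, ∀ ε₂ ∈ E, ε₁ * ε₂ = ε₂ * ε₁) →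
        E.Finite ∧ Nat.card E ≤ 2 ^ n) ∧
    (∃ E : Set (Module.End K V),
        (∀ ε ∈ E, ∀ a ∈ A₀, ε a = a) ∧
        (∀ ε₁ ∈ E, ∀ ε₂ ∈ E, ε₁ * ε₂ ∈ E) ∧
        (∀ ε ∈ E, ε * ε = ε) ∧
        (∀ ε₁ ∈ E, ∀ ε₂ ∈ E, ε₁ * ε₂ = ε₂ * ε₁) ∧
        E.Finite ∧ Nat.card E = 2 ^ n) := by
  refine ⟨fun E hfix _ hidem hcomm => ?_, ?_⟩
  · have hmap (f : E) : A₀ ≤ A₀.comap f.1 := fun a ha => by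
      rw [Submodule.mem_comap, hfix f f.2 a ha]
      exact ha
    let q : E → Module.End K (V ⧸ A₀) := fun f => A₀.mapQ A₀ f.1 (hmap f)
    have hq (f : E) (x : V) : q f (A₀.mkQ x) = A₀.mkQ (f.1 x) := rfl
    have hinj : Function.Injective q := fun f g h => Subtype.ext <|
      Module.End.eq_of_commute_of_forall_sub_mem (hfix f f.2) (hfix g g.2) (hidem f f.2)
        (hidem g g.2) (hcomm f f.2 g g.2) fun x =>
          (Submodule.Quotient.eq A₀).mp (LinearMap.congr_fun h (A₀.mkQ x))
    obtain ⟨hfin, hcard⟩ :=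
      Module.End.finite_and_ncard_le_of_commute_of_isIdempotentElem (Set.range q)
        (by
          rintro _ ⟨f, rfl⟩
          refine LinearMap.ext fun y => ?_
          obtain ⟨x, rfl⟩ := A₀.mkQ_surjective y
          exact congrArg A₀.mkQ (LinearMap.congr_fun (hidem f f.2) x))
        (by
          rintro _ ⟨f, rfl⟩ _ ⟨g, rfl⟩
          refine LinearMap.ext fun y => ?_
          obtain ⟨x, rfl⟩ := A₀.mkQ_surjective y
          exact congrArg A₀.mkQ (LinearMap.congr_fun (hcomm f f.2 g g.2) x))
    rw [← Nat.card_coe_set_eq, Nat.card_range_of_injective hinj, hn] at hcard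
    exact ⟨Set.finite_coe_iff.mp (Set.finite_range_iff hinj |>.mp hfin), hcard⟩
  · obtain ⟨C, hC⟩ := A₀.exists_isCompl
    let b : (V ⧸ A₀) ≃ₗ[K] (Fin n → K) := (Module.finBasisOfFinrankEq K (V ⧸ A₀) hn).equivFun
    let e : (A₀ × (Fin n → K)) ≃ₗ[K] V :=
      ((LinearEquiv.refl K A₀).prodCongr (b.symm.trans (A₀.quotientEquivOfIsCompl C hC))).trans
        (A₀.prodEquivOfIsCompl C hC)
    have he (a : A₀) : e (a, 0) = a := by simp [e]
    let p : Finset (Fin n) → Module.End K V := fun s => e.conjRingEquiv (Module.End.coordProj K A₀ s)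
    have hp (s t) : p s * p t = p (s ∩ t) := by
      simp only [p, ← map_mul, Module.End.coordProj_mul]
    have hinj : Function.Injective p :=
      e.conjRingEquiv.injective.comp (Module.End.coordProj_injective K A₀)
    refine ⟨Set.range p, ?_, ?_, ?_, ?_, Set.finite_range p, ?_⟩
    · rintro _ ⟨s, rfl⟩ a ha
      have hs : e.symm a = (⟨a, ha⟩, 0) := e.symm_apply_eq.mpr (he ⟨a, ha⟩).symm
      have h0 : Module.End.coordProj K A₀ s (⟨a, ha⟩, 0) = (⟨a, ha⟩, 0) := by
        ext <;> simp [Module.End.coordProj]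
      change e (Module.End.coordProj K A₀ s (e.symm a)) = a
      rw [hs, h0, he]
    · rintro _ ⟨s, rfl⟩ _ ⟨t, rfl⟩
      exact ⟨s ∩ t, (hp s t).symm⟩
    · rintro _ ⟨s, rfl⟩
      rw [hp, Finset.inter_self]
    · rintro _ ⟨s, rfl⟩ _ ⟨t, rfl⟩
      rw [hp, hp, Finset.inter_comm]
    · rw [Nat.card_range_of_injective hinj]
      simp
end
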